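/- Let (H₋, H₊, Γ₋, Γ₊) be a boundary quadruple for a densely defined skew-symmetric operator A₀ on a Hilbert space V, with A = (−A₀)*. The following assertions are equivalent: (i) there exists an operator B on V with A₀ ⊆ B such that both B and −B are m-dissipative (equivalently, B generates a unitary C₀-group); (ii) there exists a unitary operator from H₋ onto H₊; (iii) there exists a unitary operator from ker(Id − A) onto ker(Id + A). -/

import Mathlib

variable {𝕜 V : Type*} [RCLike 𝕜] [NormedAddCommGroup V] [InnerProductSpace 𝕜 V]
  [CompleteSpace V]

/-- An operator `A` on `V` is *skew-symmetric* if `⟪Au, v⟫ + ⟪u, Av⟫ = 0` for all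
`u, v ∈ D(A)`. -/
def SkewSymmetric (A : V →ₗ.[𝕜] V) : Prop :=
  ∀ u v : A.domain, @inner 𝕜 _ _ (A u) (v : V) + @inner 𝕜 _ _ (u : V) (A v) = 0

/-- A *boundary quadruple* `(H₋, H₊, Γ₋, Γ₊)` for a densely defined skew-symmetric operator
`A₀` (here expressed via `A := (-A₀)*`) consists of pre-Hilbert spaces `H₋, H₊` and surjective
linear maps `Γ₋ : D(A) → H₋`, `Γ₊ : D(A) → H₊` such that
`⟪Au, v⟫ + ⟪u, Av⟫ = ⟪Γ₊u, Γ₊v⟫ - ⟪Γ₋u, Γ₋v⟫` for all `u, v ∈ D(A)` and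
`ker Γ₋ + ker Γ₊ = D(A)`. -/
def IsBoundaryQuadruple (A : V →ₗ.[𝕜] V) {Hm Hp : Type*}
    [NormedAddCommGroup Hm] [InnerProductSpace 𝕜 Hm]
    [NormedAddCommGroup Hp] [InnerProductSpace 𝕜 Hp]
    (Γm : A.domain →ₗ[𝕜] Hm) (Γp : A.domain →ₗ[𝕜] Hp) : Prop :=
  Function.Surjective Γm ∧ Function.Surjective Γp ∧
    (∀ u v : A.domain,
      @inner 𝕜 _ _ (A u) (v : V) + @inner 𝕜 _ _ (u : V) (A v) =
        @inner 𝕜 _ _ (Γp u) (Γp v) - @inner 𝕜 _ _ (Γm u) (Γm v)) ∧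
    LinearMap.ker Γm ⊔ LinearMap.ker Γp = ⊤

/-- An operator `A` on `V` is *dissipative* if `Re ⟪Ax, x⟫ ≤ 0` for all `x ∈ D(A)`. -/
def Dissipative (A : V →ₗ.[𝕜] V) : Prop :=
  ∀ x : A.domain, RCLike.re (@inner 𝕜 _ _ (A x) (x : V)) ≤ 0

/-- `A` is *m-dissipative* if it is dissipative and `(Id - A) D(A) = V`. -/
def MDissipative (A : V →ₗ.[𝕜] V) : Prop :=
  Dissipative A ∧ ∀ y : V, ∃ x : A.domain, (x : V) - A x = y

/-- The kernel `ker(Id - T) = {x ∈ D(T) : Tx = x}`, as a submodule of `V`. -/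
def kerIdSub (T : V →ₗ.[𝕜] V) : Submodule 𝕜 V :=
  (LinearMap.ker (T.domain.subtype - T.toFun)).map T.domain.subtype

/-- The kernel `ker(Id + T) = {x ∈ D(T) : Tx = -x}`, as a submodule of `V`. -/
def kerIdAdd (T : V →ₗ.[𝕜] V) : Submodule 𝕜 V :=
  (LinearMap.ker (T.domain.subtype + T.toFun)).map T.domain.subtype

open scoped InnerProductSpace

/-- A weakly convergent Cauchy sequence in an inner product space converges. -/
theorem tendsto_of_cauchySeq_of_tendsto_inner {H : Type*} [NormedAddCommGroup H]
    [InnerProductSpace 𝕜 H] {k : ℕ → H} {y : H} (hk : CauchySeq k)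
    (hweak : ∀ x : H, Filter.Tendsto (fun n => ⟪k n, x⟫_𝕜) Filter.atTop (nhds ⟪y, x⟫_𝕜)) :
    Filter.Tendsto k Filter.atTop (nhds y) := by
  have hk' : CauchySeq fun n => (k n : UniformSpace.Completion H) :=
    (UniformSpace.Completion.uniformContinuous_coe H).comp_cauchySeq hk
  obtain ⟨b, hb⟩ := cauchySeq_tendsto_of_complete hk'
  have hby : b = y := by
    refine (UniformSpace.Completion.denseRange_coe (α := H)).eq_of_inner_left 𝕜 ?_
    intro x
    refine tendsto_nhds_unique (hb.inner tendsto_const_nhds) ?_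
    simpa using hweak x
  rw [hby] at hb
  exact (UniformSpace.Completion.isUniformInducing_coe H).isInducing.tendsto_nhds_iff.2 hb

section BoundaryForm

variable {E D : Type*} [NormedAddCommGroup E] [InnerProductSpace 𝕜 E] [AddCommGroup D]
  [Module 𝕜 D] {ι T : D →ₗ[𝕜] E}

/-- The annihilator of `Q` with respect to the boundary form `⟪T u, ι v⟫ + ⟪ι u, T v⟫`. -/
def boundaryAnnihilator (ι T : D →ₗ[𝕜] E) (Q : Submodule 𝕜 D) : Submodule 𝕜 D where
  carrier := {u | ∀ v ∈ Q, ⟪T u, ι v⟫_𝕜 + ⟪ι u, T v⟫_𝕜 = 0}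
  zero_mem' := by simp
  add_mem' := by
    intro a b ha hb v hv
    simp only [map_add, inner_add_left]
    linear_combination ha v hv + hb v hv
  smul_mem' := by
    intro c a ha v hv
    simp only [map_smul, inner_smul_left]
    linear_combination (starRingEnd 𝕜) c * ha v hv

theorem mem_boundaryAnnihilator {Q : Submodule 𝕜 D} {u : D} :
    u ∈ boundaryAnnihilator ι T Q ↔ ∀ v ∈ Q, ⟪T u, ι v⟫_𝕜 + ⟪ι u, T v⟫_𝕜 = 0 :=
  Iff.rfl

theorem boundaryAnnihilator_neg (Q : Submodule 𝕜 D) :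
    boundaryAnnihilator ι (-T) Q = boundaryAnnihilator ι T Q := by
  ext u
  refine forall₂_congr fun v _ => ?_
  simp only [LinearMap.neg_apply, inner_neg_left, inner_neg_right, ← neg_add, neg_eq_zero]

theorem boundaryForm_flip_eq_zero {u v : D} (h : ⟪T u, ι v⟫_𝕜 + ⟪ι u, T v⟫_𝕜 = 0) :
    ⟪T v, ι u⟫_𝕜 + ⟪ι v, T u⟫_𝕜 = 0 := by
  have := congrArg (starRingEnd 𝕜) h
  simp only [map_add, inner_conj_symm, map_zero] at this
  rwa [add_comm]

theorem boundaryAnnihilator_anti {P Q : Submodule 𝕜 D} (h : P ≤ Q) :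
    boundaryAnnihilator ι T Q ≤ boundaryAnnihilator ι T P :=
  fun _ hu v hv => hu v (h hv)

theorem re_inner_eq_zero_of_boundaryForm_self {u : D}
    (h : ⟪T u, ι u⟫_𝕜 + ⟪ι u, T u⟫_𝕜 = 0) : RCLike.re ⟪T u, ι u⟫_𝕜 = 0 := by
  have := congrArg RCLike.re h
  rw [map_add, inner_re_symm (ι u), map_zero] at this
  linarith

/-- The graph `{(ι u, T u)}` is the annihilator of the graph over the radical of the
boundary form. -/
def IsBoundaryMaximal (ι T : D →ₗ[𝕜] E) : Prop :=
  ∀ y z : E, (∀ u ∈ boundaryAnnihilator ι T ⊤, ⟪T u, y⟫_𝕜 + ⟪ι u, z⟫_𝕜 = 0) →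
    ∃ d, ι d = y ∧ T d = z

theorem IsBoundaryMaximal.neg (h : IsBoundaryMaximal ι T) : IsBoundaryMaximal ι (-T) := by
  intro y z hyz
  obtain ⟨d, hd, hd'⟩ := h y (-z) fun u hu => by
    have := hyz u (by rwa [boundaryAnnihilator_neg])
    simp only [LinearMap.neg_apply, inner_neg_left] at this
    rw [inner_neg_right]
    linear_combination -this
  exact ⟨d, hd, by simp [hd']⟩

theorem IsBoundaryMaximal.exists_mem_boundaryAnnihilator (h : IsBoundaryMaximal ι T)
    {Q : Submodule 𝕜 D} {a b : E} (hab : ∀ v ∈ Q, ⟪b, ι v⟫_𝕜 + ⟪a, T v⟫_𝕜 = 0)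
    (hQ : boundaryAnnihilator ι T ⊤ ≤ Q) :
    ∃ d ∈ boundaryAnnihilator ι T Q, ι d = a ∧ T d = b := by
  obtain ⟨d, rfl, rfl⟩ := h a b fun u hu => by
    have := congrArg (starRingEnd 𝕜) (hab u (hQ hu))
    simp only [map_add, inner_conj_symm, map_zero] at this
    rwa [add_comm]
  exact ⟨d, hab, rfl, rfl⟩

/-- The range of `Id - T` on a `T`-dissipative subspace is closed, provided that the subspace
is a boundary annihilator. -/
theorem IsBoundaryMaximal.isClosed_map_sub [CompleteSpace E] (h : IsBoundaryMaximal ι T)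
    {P Q : Submodule 𝕜 D}
    (hP : P = boundaryAnnihilator ι T Q) (hQ : boundaryAnnihilator ι T ⊤ ≤ Q)
    (hdiss : ∀ u ∈ P, RCLike.re ⟪T u, ι u⟫_𝕜 ≤ 0) :
    IsClosed (P.map (ι - T) : Set E) := by
  have hG : IsClosed {p : E × E | ∀ v ∈ Q, ⟪p.2, ι v⟫_𝕜 + ⟪p.1, T v⟫_𝕜 = 0} := by
    simp only [Set.ofPred_forall]
    exact isClosed_iInter fun v => isClosed_iInter fun _ =>
      isClosed_eq (by fun_prop) continuous_const
  have hGP : {p : E × E | ∀ v ∈ Q, ⟪p.2, ι v⟫_𝕜 + ⟪p.1, T v⟫_𝕜 = 0} =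
      (P.map (ι.prod T) : Set (E × E)) := by
    ext ⟨a, b⟩
    constructor
    · intro hab
      obtain ⟨d, hd, rfl, rfl⟩ := h.exists_mem_boundaryAnnihilator hab hQ
      exact ⟨d, hP ▸ hd, rfl⟩
    · rintro ⟨d, hd, hd'⟩
      obtain ⟨rfl, rfl⟩ := Prod.mk.inj hd'
      rw [hP] at hd
      exact hd
  rw [hGP] at hG
  let f : P.map (ι.prod T) →ₗ[𝕜] E :=
    (LinearMap.fst 𝕜 E E - LinearMap.snd 𝕜 E E) ∘ₗ (P.map (ι.prod T)).subtype
  have hf : AntilipschitzWith 1 f := by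
    refine AddMonoidHomClass.antilipschitz_of_bound f ?_
    rintro ⟨_, u, hu, rfl⟩
    have key := norm_sub_sq (𝕜 := 𝕜) (ι u) (T u)
    have hd := hdiss u hu
    rw [← inner_re_symm] at hd
    have h1 : ‖ι u‖ ≤ ‖ι u - T u‖ :=
      le_of_sq_le_sq (by nlinarith [sq_nonneg ‖T u‖]) (norm_nonneg _)
    have h2 : ‖T u‖ ≤ ‖ι u - T u‖ :=
      le_of_sq_le_sq (by nlinarith [sq_nonneg ‖ι u‖]) (norm_nonneg _)
    simpa [f, Prod.norm_def] using ⟨h1, h2⟩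
  have hfu : UniformContinuous f :=
    (uniformContinuous_fst.sub uniformContinuous_snd).comp uniformContinuous_subtype_val
  have : CompleteSpace (P.map (ι.prod T)) := hG.completeSpace_coe
  convert hf.isClosed_range hfu using 1
  ext x
  constructor
  · rintro ⟨u, hu, rfl⟩
    exact ⟨⟨_, u, hu, rfl⟩, by simp [f]⟩
  · rintro ⟨⟨_, u, hu, rfl⟩, rfl⟩
    exact ⟨u, hu, by simp [f]⟩

/-- If `P` and `Q` are boundary annihilators of each other, `T` is dissipative on `P` and `-T`
is dissipative on `Q`, then `Id - T` maps `P` onto the whole space. -/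
theorem IsBoundaryMaximal.exists_sub_eq [CompleteSpace E] (h : IsBoundaryMaximal ι T)
    {P Q : Submodule 𝕜 D}
    (hP : P = boundaryAnnihilator ι T Q) (hQ : Q = boundaryAnnihilator ι T P)
    (hPdiss : ∀ u ∈ P, RCLike.re ⟪T u, ι u⟫_𝕜 ≤ 0)
    (hQdiss : ∀ u ∈ Q, 0 ≤ RCLike.re ⟪T u, ι u⟫_𝕜) (y : E) :
    ∃ u ∈ P, ι u - T u = y := by
  have hNQ : boundaryAnnihilator ι T ⊤ ≤ Q := hQ ▸ boundaryAnnihilator_anti le_top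
  have hNP : boundaryAnnihilator ι T ⊤ ≤ P := hP ▸ boundaryAnnihilator_anti le_top
  have hcl := h.isClosed_map_sub hP hNQ hPdiss
  have : CompleteSpace (P.map (ι - T)) := hcl.completeSpace_coe
  suffices P.map (ι - T) = ⊤ by
    obtain ⟨u, hu, rfl⟩ := this.symm ▸ Submodule.mem_top (R := 𝕜) (x := y)
    exact ⟨u, hu, rfl⟩
  rw [← Submodule.orthogonal_eq_bot_iff, Submodule.eq_bot_iff]
  intro x hx
  have hx' : ∀ u ∈ P, ⟪T u, x⟫_𝕜 + ⟪ι u, -x⟫_𝕜 = 0 := by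
    intro u hu
    have := hx _ (Submodule.mem_map_of_mem (f := ι - T) hu)
    rw [LinearMap.sub_apply, inner_sub_left] at this
    rw [inner_neg_right]
    linear_combination -this
  obtain ⟨d, rfl, hd⟩ := h x (-x) fun u hu => hx' u (hNP hu)
  have hdQ : d ∈ Q := by
    rw [hQ]
    exact fun v hv => boundaryForm_flip_eq_zero (by rw [hd]; exact hx' v hv)
  have := hQdiss d hdQ
  rw [hd, inner_neg_left, map_neg, inner_self_eq_norm_sq] at this
  have : ‖ι d‖ ^ 2 = 0 := le_antisymm (by linarith) (sq_nonneg _)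
  simpa using this

theorem IsBoundaryMaximal.exists_sub_eq_of_eq_annihilator [CompleteSpace E]
    (h : IsBoundaryMaximal ι T) {P : Submodule 𝕜 D} (hP : P = boundaryAnnihilator ι T P) (y : E) :
    ∃ u ∈ P, ι u - T u = y := by
  have h0 : ∀ u ∈ P, RCLike.re ⟪T u, ι u⟫_𝕜 = 0 := by
    intro u hu
    have hu' := hu
    rw [hP] at hu'
    exact re_inner_eq_zero_of_boundaryForm_self (hu' u hu)
  exact h.exists_sub_eq hP hP (fun u hu => (h0 u hu).le) (fun u hu => (h0 u hu).ge) y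

/-- A skew-symmetric restriction of `T` for which `Id ± T` are onto is its own boundary
annihilator. -/
theorem eq_boundaryAnnihilator_of_surjective {P : Submodule 𝕜 D} (hι : Function.Injective ι)
    (hP : P ≤ boundaryAnnihilator ι T P) (hsub : ∀ y, ∃ u ∈ P, ι u - T u = y)
    (hadd : ∀ y, ∃ u ∈ P, ι u + T u = y) : P = boundaryAnnihilator ι T P := by
  refine le_antisymm hP fun u hu => ?_
  obtain ⟨w, hw, hwu⟩ := hadd (ι u + T u)
  have hz := Submodule.sub_mem _ hu (hP hw)
  have hTz : T (u - w) = -ι (u - w) := by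
    rw [map_sub, map_sub, ← sub_eq_zero, ← sub_eq_zero.2 hwu.symm]
    abel
  obtain ⟨v, hv, hvz⟩ := hsub (ι (u - w))
  have := hz v hv
  rw [hTz, inner_neg_left, neg_add_eq_sub, ← inner_sub_right, ← neg_sub (ι v), hvz,
    inner_neg_right, neg_eq_zero, inner_self_eq_zero] at this
  rw [sub_eq_zero.1 (hι (this.trans (map_zero ι).symm))]
  exact hw

/-- The boundary quadruple axioms for a pair of linear maps `ι T : D → E`, with `ι` in the role
of the inclusion of the domain of `T`. -/
structure IsBoundaryPair {Hm Hp : Type*} [NormedAddCommGroup Hm] [InnerProductSpace 𝕜 Hm]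
    [NormedAddCommGroup Hp] [InnerProductSpace 𝕜 Hp] (ι T : D →ₗ[𝕜] E)
    (Γm : D →ₗ[𝕜] Hm) (Γp : D →ₗ[𝕜] Hp) : Prop where
  surj_m : Function.Surjective Γm
  surj_p : Function.Surjective Γp
  form_eq : ∀ u v, ⟪T u, ι v⟫_𝕜 + ⟪ι u, T v⟫_𝕜 = ⟪Γp u, Γp v⟫_𝕜 - ⟪Γm u, Γm v⟫_𝕜
  ker_sup : LinearMap.ker Γm ⊔ LinearMap.ker Γp = ⊤

namespace IsBoundaryPair

variable {Hm Hp : Type*} [NormedAddCommGroup Hm] [InnerProductSpace 𝕜 Hm]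
  [NormedAddCommGroup Hp] [InnerProductSpace 𝕜 Hp] {Γm : D →ₗ[𝕜] Hm} {Γp : D →ₗ[𝕜] Hp}

theorem neg (hq : IsBoundaryPair ι T Γm Γp) : IsBoundaryPair ι (-T) Γp Γm where
  surj_m := hq.surj_p
  surj_p := hq.surj_m
  form_eq u v := by
    simp only [LinearMap.neg_apply, inner_neg_left, inner_neg_right]
    linear_combination -hq.form_eq u v
  ker_sup := sup_comm (LinearMap.ker Γm) _ ▸ hq.ker_sup

theorem exists_eq (hq : IsBoundaryPair ι T Γm Γp) (h : Hm) (k : Hp) :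
    ∃ u, Γm u = h ∧ Γp u = k := by
  obtain ⟨a, rfl⟩ := hq.surj_m h
  obtain ⟨b, rfl⟩ := hq.surj_p k
  obtain ⟨a₁, ha₁, a₂, ha₂, rfl⟩ :=
    Submodule.mem_sup.1 (hq.ker_sup.symm ▸ Submodule.mem_top (R := 𝕜) (x := a))
  obtain ⟨b₁, hb₁, b₂, hb₂, rfl⟩ :=
    Submodule.mem_sup.1 (hq.ker_sup.symm ▸ Submodule.mem_top (R := 𝕜) (x := b))
  rw [LinearMap.mem_ker] at ha₁ ha₂ hb₁ hb₂
  exact ⟨a₂ + b₁, by simp [*], by simp [*]⟩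

theorem ker_eq_boundaryAnnihilator (hq : IsBoundaryPair ι T Γm Γp) :
    LinearMap.ker Γp = boundaryAnnihilator ι T (LinearMap.ker Γm) := by
  ext u
  constructor
  · intro hu v hv
    rw [LinearMap.mem_ker] at hu hv
    simp [hq.form_eq, hu, hv]
  · intro hu
    obtain ⟨v, hv, hv'⟩ := hq.exists_eq 0 (Γp u)
    have := hu v hv
    rwa [hq.form_eq, hv, hv', inner_zero_right, sub_zero, inner_self_eq_zero] at this

theorem two_mul_re_inner (hq : IsBoundaryPair ι T Γm Γp) (u : D) :
    2 * RCLike.re ⟪T u, ι u⟫_𝕜 = ‖Γp u‖ ^ 2 - ‖Γm u‖ ^ 2 := by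
  have := congrArg RCLike.re (hq.form_eq u u)
  rw [map_add, inner_re_symm (ι u), map_sub, inner_self_eq_norm_sq, inner_self_eq_norm_sq] at this
  linarith

/-- The boundary map `Γp` maps `ker (Id - T)` onto `Hp`. -/
theorem exists_mem_kernel [CompleteSpace E] (hq : IsBoundaryPair ι T Γm Γp)
    (h : IsBoundaryMaximal ι T) (k : Hp) :
    ∃ u, T u = ι u ∧ Γp u = k := by
  obtain ⟨w, rfl⟩ := hq.surj_p k
  have hm := hq.neg.ker_eq_boundaryAnnihilator
  rw [boundaryAnnihilator_neg] at hm
  obtain ⟨v, hv, hvw⟩ := h.exists_sub_eq hq.ker_eq_boundaryAnnihilator hm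
    (fun u hu => by
      have := hq.two_mul_re_inner u
      rw [LinearMap.mem_ker.1 hu, norm_zero] at this
      nlinarith [sq_nonneg ‖Γm u‖])
    (fun u hu => by
      have := hq.two_mul_re_inner u
      rw [LinearMap.mem_ker.1 hu, norm_zero] at this
      nlinarith [sq_nonneg ‖Γp u‖]) (ι w - T w)
  refine ⟨w - v, ?_, by simp [LinearMap.mem_ker.1 hv]⟩
  rw [map_sub, map_sub, ← sub_eq_zero, ← sub_eq_zero.2 hvw]
  abel

/-- The boundary space `Hp` is automatically complete. -/
theorem completeSpace [CompleteSpace E] (hq : IsBoundaryPair ι T Γm Γp)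
    (h : IsBoundaryMaximal ι T) :
    CompleteSpace Hp := by
  refine Metric.complete_of_cauchySeq_tendsto fun k hk => ?_
  choose u hTu hΓu using fun n => hq.exists_mem_kernel h (k n)
  have hbound : ∀ n m, dist (ι (u n)) (ι (u m)) ≤ dist (k n) (k m) := by
    intro n m
    have := hq.two_mul_re_inner (u n - u m)
    rw [map_sub, hTu, hTu, ← map_sub, inner_self_eq_norm_sq, map_sub ι, map_sub Γp, hΓu,
      hΓu] at this
    rw [dist_eq_norm, dist_eq_norm]
    exact le_of_sq_le_sq (by
      nlinarith [sq_nonneg ‖ι (u n) - ι (u m)‖, sq_nonneg ‖Γm (u n - u m)‖]) (norm_nonneg _)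
  have hc : CauchySeq fun n => ι (u n) := by
    rw [Metric.cauchySeq_iff] at hk ⊢
    intro ε hε
    obtain ⟨N, hN⟩ := hk ε hε
    exact ⟨N, fun m hm n hn => (hbound m n).trans_lt (hN m hm n hn)⟩
  obtain ⟨a, ha⟩ := cauchySeq_tendsto_of_complete hc
  obtain ⟨d, hd, hTd⟩ := h a a fun v hv => by
    refine tendsto_nhds_unique (f := fun n => ⟪T v, ι (u n)⟫_𝕜 + ⟪ι v, ι (u n)⟫_𝕜)
      (l := Filter.atTop) ((tendsto_const_nhds.inner ha).add (tendsto_const_nhds.inner ha)) ?_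
    refine tendsto_const_nhds.congr fun n => ?_
    have := hv (u n) trivial
    rw [hTu] at this
    exact this.symm
  refine ⟨Γp d, ?_⟩
  have hweak : ∀ x : Hp, Filter.Tendsto (fun n => ⟪k n, x⟫_𝕜) Filter.atTop
      (nhds ⟪Γp d, x⟫_𝕜) := by
    intro x
    obtain ⟨v, hv, rfl⟩ := hq.exists_eq 0 x
    have key : ∀ w : D, ⟪Γp w, Γp v⟫_𝕜 = ⟪T w, ι v⟫_𝕜 + ⟪ι w, T v⟫_𝕜 := by
      intro w
      rw [hq.form_eq, hv, inner_zero_right, sub_zero]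
    simp only [← hΓu, key, hTu, hTd, hd]
    exact (ha.inner tendsto_const_nhds).add (ha.inner tendsto_const_nhds)
  exact tendsto_of_cauchySeq_of_tendsto_inner hk hweak

/-- The graph of a unitary operator between the boundary spaces gives a self-annihilating
subspace. -/
theorem ker_sub_eq_boundaryAnnihilator (hq : IsBoundaryPair ι T Γm Γp) (U : Hm ≃ₗᵢ[𝕜] Hp) :
    LinearMap.ker (Γp - U.toLinearEquiv.toLinearMap ∘ₗ Γm) =
      boundaryAnnihilator ι T (LinearMap.ker (Γp - U.toLinearEquiv.toLinearMap ∘ₗ Γm)) := by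
  have hmem : ∀ u, u ∈ LinearMap.ker (Γp - U.toLinearEquiv.toLinearMap ∘ₗ Γm) ↔
      Γp u = U (Γm u) := fun u => by simp [sub_eq_zero]
  ext u
  rw [mem_boundaryAnnihilator]
  simp only [hmem]
  constructor
  · intro hu v hv
    rw [hq.form_eq, hu, hv, U.inner_map_map, sub_self]
  · intro hu
    obtain ⟨v, hv, hv'⟩ :=
      hq.exists_eq (U.symm (Γp u - U (Γm u))) (Γp u - U (Γm u))
    have := hu v (by rw [hv, hv', U.apply_symm_apply])
    rw [hq.form_eq, hv, hv', ← U.inner_map_map (Γm u), U.apply_symm_apply, ← inner_sub_left,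
      inner_self_eq_zero] at this
    exact sub_eq_zero.1 this

theorem norm_eq_of_mem (hq : IsBoundaryPair ι T Γm Γp) {P : Submodule 𝕜 D}
    (hP : P = boundaryAnnihilator ι T P) {u : D} (hu : u ∈ P) : ‖Γm u‖ = ‖Γp u‖ := by
  have hu' := hu
  rw [hP] at hu'
  have h1 := hq.two_mul_re_inner u
  rw [re_inner_eq_zero_of_boundaryForm_self (hu' u hu)] at h1
  exact (sq_eq_sq₀ (norm_nonneg _) (norm_nonneg _)).1 (by linarith)

/-- A self-annihilating subspace is mapped onto `Hm` by `Γm`. -/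
theorem exists_mem_eq [CompleteSpace Hm] [CompleteSpace Hp] (hq : IsBoundaryPair ι T Γm Γp)
    {P : Submodule 𝕜 D} (hP : P = boundaryAnnihilator ι T P) (h : Hm) :
    ∃ u ∈ P, Γm u = h := by
  have hG : IsClosed {p : Hm × Hp | ∀ v ∈ P, ⟪p.2, Γp v⟫_𝕜 - ⟪p.1, Γm v⟫_𝕜 = 0} := by
    simp only [Set.ofPred_forall]
    exact isClosed_iInter fun v => isClosed_iInter fun _ =>
      isClosed_eq (by fun_prop) continuous_const
  have hGP : {p : Hm × Hp | ∀ v ∈ P, ⟪p.2, Γp v⟫_𝕜 - ⟪p.1, Γm v⟫_𝕜 = 0} =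
      (P.map (Γm.prod Γp) : Set (Hm × Hp)) := by
    ext ⟨a, b⟩
    constructor
    · intro hab
      obtain ⟨d, rfl, rfl⟩ := hq.exists_eq a b
      refine ⟨d, ?_, rfl⟩
      rw [hP]
      intro v hv
      rw [hq.form_eq]
      exact hab v hv
    · rintro ⟨d, hd, hd'⟩
      obtain ⟨rfl, rfl⟩ := Prod.mk.inj hd'
      rw [hP] at hd
      intro v hv
      rw [← hq.form_eq]
      exact hd v hv
  rw [hGP] at hG
  let f : P.map (Γm.prod Γp) →ₗ[𝕜] Hm := LinearMap.fst 𝕜 Hm Hp ∘ₗ (P.map (Γm.prod Γp)).subtype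
  have hf : AntilipschitzWith 1 f := by
    refine AddMonoidHomClass.antilipschitz_of_bound f ?_
    rintro ⟨_, u, hu, rfl⟩
    simp [f, Prod.norm_def, hq.norm_eq_of_mem hP hu]
  have hfu : UniformContinuous f := uniformContinuous_fst.comp uniformContinuous_subtype_val
  have : CompleteSpace (P.map (Γm.prod Γp)) := hG.completeSpace_coe
  have hcl : IsClosed (P.map Γm : Set Hm) := by
    convert hf.isClosed_range hfu using 1
    ext x
    constructor
    · rintro ⟨u, hu, rfl⟩
      exact ⟨⟨_, u, hu, rfl⟩, rfl⟩
    · rintro ⟨⟨_, u, hu, rfl⟩, rfl⟩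
      exact ⟨u, hu, rfl⟩
  have : CompleteSpace (P.map Γm) := hcl.completeSpace_coe
  suffices htop : P.map Γm = ⊤ from Submodule.mem_map.1 (htop ▸ Submodule.mem_top)
  rw [← Submodule.orthogonal_eq_bot_iff, Submodule.eq_bot_iff]
  intro x hx
  obtain ⟨d, rfl, hd⟩ := hq.exists_eq x 0
  have hdP : d ∈ P := by
    rw [hP]
    intro v hv
    rw [hq.form_eq, hd, inner_zero_left, zero_sub, neg_eq_zero]
    exact Submodule.inner_left_of_mem_orthogonal (Submodule.mem_map_of_mem hv) hx
  have := hq.norm_eq_of_mem hP hdP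
  rwa [hd, norm_zero, norm_eq_zero] at this

/-- Self-annihilating subspaces exist exactly when the boundary spaces are unitarily
isomorphic. -/
theorem exists_eq_boundaryAnnihilator_iff [CompleteSpace E] (hq : IsBoundaryPair ι T Γm Γp)
    (h : IsBoundaryMaximal ι T) :
    (∃ P, P = boundaryAnnihilator ι T P) ↔ Nonempty (Hm ≃ₗᵢ[𝕜] Hp) := by
  refine ⟨?_, fun ⟨U⟩ => ⟨_, hq.ker_sub_eq_boundaryAnnihilator U⟩⟩
  rintro ⟨P, hP⟩
  have := hq.completeSpace h
  have := hq.neg.completeSpace h.neg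
  have hP' : P = boundaryAnnihilator ι (-T) P := by rwa [boundaryAnnihilator_neg]
  let G := P.map (Γm.prod Γp)
  have hG : ∀ p ∈ G, ‖p.1‖ = ‖p.2‖ := by
    rintro _ ⟨u, hu, rfl⟩
    exact hq.norm_eq_of_mem hP hu
  let fm : G →ₗ[𝕜] Hm := LinearMap.fst 𝕜 Hm Hp ∘ₗ G.subtype
  let fp : G →ₗ[𝕜] Hp := LinearMap.snd 𝕜 Hm Hp ∘ₗ G.subtype
  have hfm : Function.Bijective fm := by
    refine ⟨(injective_iff_map_eq_zero fm).2 ?_, fun x => ?_⟩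
    · rintro ⟨⟨a, b⟩, hp⟩ (rfl : a = 0)
      have : b = 0 := norm_eq_zero.1 (by simpa using (hG _ hp).symm)
      exact Subtype.ext (by simp [this])
    · obtain ⟨u, hu, rfl⟩ := hq.exists_mem_eq hP x
      exact ⟨⟨_, Submodule.mem_map_of_mem hu⟩, rfl⟩
  have hfp : Function.Bijective fp := by
    refine ⟨(injective_iff_map_eq_zero fp).2 ?_, fun x => ?_⟩
    · rintro ⟨⟨a, b⟩, hp⟩ (rfl : b = 0)
      have : a = 0 := norm_eq_zero.1 (by simpa using hG _ hp)
      exact Subtype.ext (by simp [this])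
    · obtain ⟨u, hu, rfl⟩ := hq.neg.exists_mem_eq hP' x
      exact ⟨⟨_, Submodule.mem_map_of_mem hu⟩, rfl⟩
  refine ⟨⟨(LinearEquiv.ofBijective fm hfm).symm ≪≫ₗ LinearEquiv.ofBijective fp hfp, ?_⟩⟩
  intro x
  obtain ⟨g, rfl⟩ := (LinearEquiv.ofBijective fm hfm).surjective x
  rw [LinearEquiv.trans_apply, LinearEquiv.symm_apply_apply]
  exact (hG _ g.2).symm

end IsBoundaryPair

theorem mem_map_ker_sub {x : E} :
    x ∈ (LinearMap.ker (ι - T)).map ι ↔ ∃ d, ι d = x ∧ T d = x := by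
  constructor
  · rintro ⟨d, hd, rfl⟩
    exact ⟨d, rfl, (sub_eq_zero.1 hd).symm⟩
  · rintro ⟨d, rfl, hd⟩
    exact ⟨d, sub_eq_zero.2 hd.symm, rfl⟩

theorem mem_map_ker_add {x : E} :
    x ∈ (LinearMap.ker (ι + T)).map ι ↔ ∃ d, ι d = x ∧ T d = -x := by
  constructor
  · rintro ⟨d, hd, rfl⟩
    exact ⟨d, rfl, (neg_eq_of_add_eq_zero_right hd).symm⟩
  · rintro ⟨d, rfl, hd⟩
    exact ⟨d, by simp [hd], rfl⟩

theorem IsBoundaryMaximal.orthogonal_map_add (h : IsBoundaryMaximal ι T) :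
    ((boundaryAnnihilator ι T ⊤).map (ι + T))ᗮ = (LinearMap.ker (ι - T)).map ι := by
  ext x
  rw [mem_map_ker_sub, Submodule.mem_orthogonal]
  constructor
  · intro hx
    refine h x x fun u hu => ?_
    rw [← hx _ (Submodule.mem_map_of_mem hu), LinearMap.add_apply, inner_add_left, add_comm]
  · rintro ⟨d, rfl, hd⟩ _ ⟨u, hu, rfl⟩
    have := hu d trivial
    rw [hd] at this
    rw [LinearMap.add_apply, inner_add_left, add_comm, this]

theorem IsBoundaryMaximal.orthogonal_map_sub (h : IsBoundaryMaximal ι T) :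
    ((boundaryAnnihilator ι T ⊤).map (ι - T))ᗮ = (LinearMap.ker (ι + T)).map ι := by
  have := h.neg.orthogonal_map_add
  rwa [boundaryAnnihilator_neg, ← sub_eq_add_neg, sub_neg_eq_add] at this

variable [CompleteSpace E]

theorem IsBoundaryMaximal.isClosed_map_add (h : IsBoundaryMaximal ι T) :
    IsClosed ((boundaryAnnihilator ι T ⊤).map (ι + T) : Set E) := by
  have := h.neg.isClosed_map_sub (P := boundaryAnnihilator ι T ⊤) (Q := ⊤)
    (by rw [boundaryAnnihilator_neg]) le_top fun u hu => by
      rw [LinearMap.neg_apply, inner_neg_left, map_neg,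
        re_inner_eq_zero_of_boundaryForm_self (hu u trivial), neg_zero]
  rwa [sub_neg_eq_add] at this

theorem IsBoundaryMaximal.mem_boundaryAnnihilator_top (h : IsBoundaryMaximal ι T) {w : D}
    (hp : ι w + T w ∈ ((LinearMap.ker (ι - T)).map ι)ᗮ)
    (hm : ι w - T w ∈ ((LinearMap.ker (ι + T)).map ι)ᗮ) :
    w ∈ boundaryAnnihilator ι T ⊤ := by
  have : CompleteSpace ((boundaryAnnihilator ι T ⊤).map (ι + T)) :=
    h.isClosed_map_add.completeSpace_coe
  rw [← h.orthogonal_map_add, Submodule.orthogonal_orthogonal] at hp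
  obtain ⟨n, hn, hnw⟩ := hp
  rw [LinearMap.add_apply] at hnw
  have hz : T (w - n) = -ι (w - n) := by
    rw [map_sub, map_sub, ← sub_eq_zero, ← sub_eq_zero.2 hnw.symm]
    abel
  have hzK : ι (w - n) ∈ (LinearMap.ker (ι + T)).map ι :=
    Submodule.mem_map_of_mem (by simp [LinearMap.mem_ker, hz])
  have hn' : ι n - T n ∈ ((LinearMap.ker (ι + T)).map ι)ᗮ := by
    rw [← h.orthogonal_map_sub]
    exact Submodule.le_orthogonal_orthogonal _ (Submodule.mem_map_of_mem (f := ι - T) hn)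
  have hzo := Submodule.sub_mem _ hm hn'
  have h2 : ι w - T w - (ι n - T n) = (2 : 𝕜) • ι (w - n) := by
    rw [two_smul]
    nth_rewrite 2 [← neg_neg (ι (w - n))]
    rw [← hz, map_sub, map_sub]
    abel
  have h0 := hzo _ hzK
  rw [h2, inner_smul_right, mul_eq_zero, or_iff_right two_ne_zero, inner_self_eq_zero] at h0
  have hzN : w - n ∈ boundaryAnnihilator ι T ⊤ := fun v _ => by rw [hz, h0]; simp
  simpa using add_mem hzN hn

/-- The kernels of `Id + T` and `Id - T`, with rescaled orthogonal projections, form a boundary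
quadruple. -/
theorem IsBoundaryMaximal.exists_isBoundaryPair_ker (h : IsBoundaryMaximal ι T) :
    ∃ (Γm : D →ₗ[𝕜] (LinearMap.ker (ι + T)).map ι) (Γp : D →ₗ[𝕜] (LinearMap.ker (ι - T)).map ι),
      IsBoundaryPair ι T Γm Γp := by
  have hKp : CompleteSpace ((LinearMap.ker (ι - T)).map ι) := by
    rw [← h.orthogonal_map_add]
    infer_instance
  have hKm : CompleteSpace ((LinearMap.ker (ι + T)).map ι) := by
    rw [← h.orthogonal_map_sub]
    infer_instance
  set Kp := (LinearMap.ker (ι - T)).map ι with hKp_def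
  set Km := (LinearMap.ker (ι + T)).map ι with hKm_def
  let πp : D →ₗ[𝕜] Kp := Kp.orthogonalProjectionOnto.toLinearMap ∘ₗ (ι + T)
  let πm : D →ₗ[𝕜] Km := Km.orthogonalProjectionOnto.toLinearMap ∘ₗ (ι - T)
  have hp_lift : ∀ x : Kp, ∃ d, T d = ι d ∧ (x : E) = (2 : 𝕜) • ι d ∧ πp d = x ∧ πm d = 0 := by
    intro x
    obtain ⟨d, hd, hTd⟩ := mem_map_ker_sub.1 ((2⁻¹ : 𝕜) • x).2
    have hx : (x : E) = (2 : 𝕜) • ι d := by simp [hd]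
    refine ⟨d, hTd.trans hd.symm, hx, ?_, by simp [πm, hd, hTd]⟩
    have : (ι + T) d = x := by rw [LinearMap.add_apply, hTd, ← hd, hx, two_smul]
    simp [πp, this]
  have hm_lift : ∀ x : Km, ∃ d, T d = -ι d ∧ (x : E) = (2 : 𝕜) • ι d ∧ πm d = x ∧ πp d = 0 := by
    intro x
    obtain ⟨d, hd, hTd⟩ := mem_map_ker_add.1 ((2⁻¹ : 𝕜) • x).2
    have hTd' : T d = -ι d := by rw [hd, hTd]
    have hx : (x : E) = (2 : 𝕜) • ι d := by simp [hd]
    refine ⟨d, hTd', hx, ?_, by simp [πp, hTd']⟩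
    have : (ι - T) d = x := by rw [LinearMap.sub_apply, hTd', sub_neg_eq_add, hx, two_smul]
    simp [πm, this]
  have hdecomp : ∀ u, ∃ a b, T a = ι a ∧ T b = -ι b ∧ (πp u : E) = (2 : 𝕜) • ι a ∧
      (πm u : E) = (2 : 𝕜) • ι b ∧ u - (a + b) ∈ boundaryAnnihilator ι T ⊤ := by
    intro u
    obtain ⟨a, hTa, ha, -, -⟩ := hp_lift (πp u)
    obtain ⟨b, hTb, hb, -, -⟩ := hm_lift (πm u)
    refine ⟨a, b, hTa, hTb, ha, hb, h.mem_boundaryAnnihilator_top ?_ ?_⟩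
    · have : ι (u - (a + b)) + T (u - (a + b)) = (ι + T) u - πp u := by
        rw [ha, two_smul]
        simp only [map_sub, map_add, hTa, hTb, LinearMap.add_apply]
        abel
      rw [this]
      exact Kp.sub_starProjection_mem_orthogonal _
    · have : ι (u - (a + b)) - T (u - (a + b)) = (ι - T) u - πm u := by
        rw [hb, two_smul]
        simp only [map_sub, map_add, hTa, hTb, LinearMap.sub_apply]
        abel
      rw [this]
      exact Km.sub_starProjection_mem_orthogonal _
  obtain ⟨c, hc⟩ : ∃ c : 𝕜, starRingEnd 𝕜 c * c = 2⁻¹ := by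
    refine ⟨((√2⁻¹ : ℝ) : 𝕜), ?_⟩
    rw [RCLike.conj_ofReal, ← RCLike.ofReal_mul, Real.mul_self_sqrt (by positivity),
      RCLike.ofReal_inv, RCLike.ofReal_ofNat]
  have hc0 : c ≠ 0 := by
    rintro rfl
    simp at hc
  refine ⟨c • πm, c • πp, ?_, ?_, ?_, ?_⟩
  · intro x
    obtain ⟨d, -, -, hd, -⟩ := hm_lift (c⁻¹ • x)
    exact ⟨d, by simp [hd, hc0]⟩
  · intro x
    obtain ⟨d, -, -, hd, -⟩ := hp_lift (c⁻¹ • x)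
    exact ⟨d, by simp [hd, hc0]⟩
  · intro u v
    obtain ⟨a, b, hTa, hTb, ha, hb, hn⟩ := hdecomp u
    obtain ⟨a', b', hTa', hTb', ha', hb', hn'⟩ := hdecomp v
    have h1 := hn v trivial
    have h2 := boundaryForm_flip_eq_zero (hn' (a + b) trivial)
    simp only [LinearMap.smul_apply, inner_smul_left, inner_smul_right, Submodule.coe_inner,
      ha, ha', hb, hb']
    simp only [map_sub, map_add, inner_sub_left, inner_sub_right, inner_add_left,
      inner_add_right, hTa, hTa', hTb, hTb', inner_neg_left, inner_neg_right, map_ofNat] at h1 h2 ⊢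
    linear_combination h1 + h2 - 4 * hc * (⟪ι a, ι a'⟫_𝕜 - ⟪ι b, ι b'⟫_𝕜)
  · rw [eq_top_iff]
    intro u _
    obtain ⟨d, -, -, hd, hd'⟩ := hp_lift (πp u)
    exact Submodule.mem_sup.2 ⟨d, by simp [hd'], u - d, by simp [hd], by abel⟩

end BoundaryForm

/-- An operator with `Re ⟪B x, x⟫ = 0` for all `x` is skew-symmetric. -/
theorem skewSymmetric_of_dissipative {E : Type*} [NormedAddCommGroup E] [InnerProductSpace 𝕜 E]
    {B : E →ₗ.[𝕜] E} (hB : Dissipative B) (hB' : Dissipative (-B)) : SkewSymmetric B := by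
  have h0 : ∀ x : B.domain, RCLike.re ⟪B x, (x : E)⟫_𝕜 = 0 := by
    intro x
    refine le_antisymm (hB x) ?_
    have := hB' x
    rw [LinearPMap.neg_apply, inner_neg_left, map_neg] at this
    linarith
  have h1 : ∀ x y : B.domain, RCLike.re (⟪B x, (y : E)⟫_𝕜 + ⟪(x : E), B y⟫_𝕜) = 0 := by
    intro x y
    have := h0 (x + y)
    rw [LinearPMap.map_add, Submodule.coe_add, inner_add_left, inner_add_right, inner_add_right,
      map_add, map_add, map_add, h0, h0, inner_re_symm (B y)] at this
    rw [map_add]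
    linarith
  intro u v
  have := h1 ((⟪B u, (v : E)⟫_𝕜 + ⟪(u : E), B v⟫_𝕜) • u) v
  rw [LinearPMap.map_smul, Submodule.coe_smul, inner_smul_left, inner_smul_left, ← mul_add,
    RCLike.conj_mul, ← RCLike.ofReal_pow, RCLike.ofReal_re] at this
  simpa using this

/-- A skew-symmetric extension of `A₀` is a restriction of `(-A₀)*`. -/
theorem SkewSymmetric.le_adjoint_neg {A₀ B : V →ₗ.[𝕜] V} (hdense : Dense (A₀.domain : Set V))
    (hB : SkewSymmetric B) (hle : A₀ ≤ B) : B ≤ (-A₀).adjoint := by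
  refine LinearPMap.IsFormalAdjoint.le_adjoint (T := -A₀) hdense fun x y => ?_
  have := hB ⟨x, hle.1 x.2⟩ y
  rw [← hle.2 (x := x) (y := ⟨x, hle.1 x.2⟩) rfl] at this
  rw [LinearPMap.neg_apply, inner_neg_left]
  linear_combination -this

theorem mem_boundaryAnnihilator_top_of_mem_domain {A₀ : V →ₗ.[𝕜] V}
    (hdense : Dense (A₀.domain : Set V)) (hle : A₀ ≤ (-A₀).adjoint) (x : A₀.domain) :
    (⟨x, hle.1 x.2⟩ : (-A₀).adjoint.domain) ∈
      boundaryAnnihilator (-A₀).adjoint.domain.subtype (-A₀).adjoint.toFun ⊤ := by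
  intro v _
  have hx := hle.2 (x := x) (y := ⟨x, hle.1 x.2⟩) rfl
  have hv := LinearPMap.adjoint_isFormalAdjoint (T := -A₀) hdense v x
  rw [LinearPMap.neg_apply, inner_neg_right] at hv
  have hv' := congrArg (starRingEnd 𝕜) hv
  simp only [map_neg, inner_conj_symm] at hv'
  change ⟪(-A₀).adjoint _, (v : V)⟫_𝕜 + ⟪(x : V), (-A₀).adjoint v⟫_𝕜 = 0
  rw [← hx, hv', add_neg_cancel]

theorem isBoundaryMaximal_adjoint_neg {A₀ : V →ₗ.[𝕜] V} (hdense : Dense (A₀.domain : Set V))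
    (hskew : SkewSymmetric A₀) :
    IsBoundaryMaximal (-A₀).adjoint.domain.subtype (-A₀).adjoint.toFun := by
  intro y z hyz
  have hle := hskew.le_adjoint_neg hdense le_rfl
  have hyz' : ∀ x : (-A₀).domain, ⟪z, (x : V)⟫_𝕜 = ⟪y, (-A₀) x⟫_𝕜 := by
    intro x
    have hx := hle.2 (x := x) (y := ⟨x, hle.1 x.2⟩) rfl
    have := hyz _ (mem_boundaryAnnihilator_top_of_mem_domain hdense hle x)
    change ⟪(-A₀).adjoint _, y⟫_𝕜 + ⟪(x : V), z⟫_𝕜 = 0 at this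
    rw [← hx] at this
    have := congrArg (starRingEnd 𝕜) this
    simp only [map_add, inner_conj_symm, map_zero] at this
    rw [LinearPMap.neg_apply, inner_neg_right]
    linear_combination this
  exact ⟨⟨y, LinearPMap.mem_adjoint_domain_of_exists y ⟨z, hyz'⟩⟩, rfl,
    LinearPMap.adjoint_apply_eq (T := -A₀) hdense _ hyz'⟩

/-- The extensions `B` of `A₀` with `B` and `-B` m-dissipative correspond to the self-annihilating
subspaces of the domain of `(-A₀)*`. -/
theorem exists_mDissipative_extension_iff {A₀ : V →ₗ.[𝕜] V} (hdense : Dense (A₀.domain : Set V))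
    (hskew : SkewSymmetric A₀) :
    (∃ B : V →ₗ.[𝕜] V, A₀ ≤ B ∧ MDissipative B ∧ MDissipative (-B)) ↔
      ∃ P, P = boundaryAnnihilator (-A₀).adjoint.domain.subtype (-A₀).adjoint.toFun P := by
  have hmax := isBoundaryMaximal_adjoint_neg hdense hskew
  have hle := hskew.le_adjoint_neg hdense le_rfl
  constructor
  · rintro ⟨B, hAB, hB, hB'⟩
    have hBskew := skewSymmetric_of_dissipative hB.1 hB'.1
    have hBA := hBskew.le_adjoint_neg hdense hAB
    have hval : ∀ (u : (-A₀).adjoint.domain) (hu : (u : V) ∈ B.domain),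
        (-A₀).adjoint.toFun u = B ⟨u, hu⟩ := fun u hu => (hBA.2 rfl).symm
    refine ⟨B.domain.comap (-A₀).adjoint.domain.subtype,
      eq_boundaryAnnihilator_of_surjective Subtype.val_injective ?_ ?_ ?_⟩
    · intro u hu v hv
      rw [hval u hu, hval v hv]
      exact hBskew ⟨u, hu⟩ ⟨v, hv⟩
    · intro y
      obtain ⟨x, rfl⟩ := hB.2 y
      refine ⟨⟨x, hBA.1 x.2⟩, x.2, ?_⟩
      rw [hval _ x.2]
      rfl
    · intro y
      obtain ⟨x, rfl⟩ := hB'.2 y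
      refine ⟨⟨x, hBA.1 x.2⟩, x.2, ?_⟩
      rw [hval _ x.2, LinearPMap.neg_apply, sub_neg_eq_add]
      rfl
  · rintro ⟨P, hP⟩
    have hre : ∀ u ∈ P, RCLike.re ⟪(-A₀).adjoint u, (u : V)⟫_𝕜 = 0 := by
      intro u hu
      have hu' := hu
      rw [hP] at hu'
      exact re_inner_eq_zero_of_boundaryForm_self (hu' u hu)
    let B : V →ₗ.[𝕜] V := (-A₀).adjoint.domRestrict (P.map (-A₀).adjoint.domain.subtype)
    have hmem : ∀ u ∈ P, (u : V) ∈ B.domain := fun u hu => ⟨Submodule.mem_map_of_mem hu, u.2⟩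
    have hB : ∀ x : B.domain, ∃ u ∈ P, (u : V) = x ∧ B x = (-A₀).adjoint u := by
      rintro ⟨_, ⟨u, hu, rfl⟩, hx⟩
      exact ⟨u, hu, rfl, LinearPMap.domRestrict_apply rfl⟩
    have hBu : ∀ (u) (hu : u ∈ P), B ⟨u, hmem u hu⟩ = (-A₀).adjoint u :=
      fun u hu => LinearPMap.domRestrict_apply rfl
    have hA₀P : ∀ x : A₀.domain, ⟨x, hle.1 x.2⟩ ∈ P := by
      intro x
      rw [hP]
      exact boundaryAnnihilator_anti le_top
        (mem_boundaryAnnihilator_top_of_mem_domain hdense hle x)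
    refine ⟨B, ⟨fun x hx => hmem _ (hA₀P ⟨x, hx⟩), ?_⟩, ⟨?_, ?_⟩, ⟨?_, ?_⟩⟩
    · intro x y hxy
      obtain ⟨u, -, huy, hBy⟩ := hB y
      rw [hBy]
      exact hle.2 (hxy.trans huy.symm)
    · intro x
      obtain ⟨u, hu, hux, hBx⟩ := hB x
      rw [hBx, ← hux, hre u hu]
    · intro y
      obtain ⟨u, hu, rfl⟩ := hmax.exists_sub_eq_of_eq_annihilator hP y
      exact ⟨⟨u, hmem u hu⟩, by rw [hBu u hu]; rfl⟩
    · intro x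
      obtain ⟨u, hu, hux, hBx⟩ := hB x
      rw [LinearPMap.neg_apply, hBx, ← hux, inner_neg_left, map_neg, hre u hu, neg_zero]
    · intro y
      obtain ⟨u, hu, rfl⟩ := hmax.neg.exists_sub_eq_of_eq_annihilator
        (by rwa [boundaryAnnihilator_neg]) y
      exact ⟨⟨u, hmem u hu⟩, by rw [LinearPMap.neg_apply, hBu u hu]; rfl⟩

/-- Let `(H₋, H₊, Γ₋, Γ₊)` be a boundary quadruple for `A₀`, with `A = (-A₀)*`.
The following are equivalent: (i) there is an extension `B` of `A₀` such that `B` and `-B`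
are m-dissipative (i.e. `B` generates a unitary `C₀`-group); (ii) `H₋` and `H₊` are
unitarily isomorphic; (iii) `ker(Id - A)` and `ker(Id + A)` are unitarily isomorphic. -/
theorem exists_unitary_extension_tfae {Hm Hp : Type*}
    [NormedAddCommGroup Hm] [InnerProductSpace 𝕜 Hm]
    [NormedAddCommGroup Hp] [InnerProductSpace 𝕜 Hp]
    (A₀ : V →ₗ.[𝕜] V) (hdense : Dense (A₀.domain : Set V)) (hskew : SkewSymmetric A₀)
    (Γm : ((-A₀).adjoint).domain →ₗ[𝕜] Hm) (Γp : ((-A₀).adjoint).domain →ₗ[𝕜] Hp)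
    (hq : IsBoundaryQuadruple (-A₀).adjoint Γm Γp) :
    ((∃ B : V →ₗ.[𝕜] V, A₀ ≤ B ∧ MDissipative B ∧ MDissipative (-B)) ↔
        Nonempty (Hm ≃ₗᵢ[𝕜] Hp)) ∧
      (Nonempty (Hm ≃ₗᵢ[𝕜] Hp) ↔
        Nonempty (↥(kerIdSub (-A₀).adjoint) ≃ₗᵢ[𝕜] ↥(kerIdAdd (-A₀).adjoint))) := by
  have hmax := isBoundaryMaximal_adjoint_neg hdense hskew
  have hpair : IsBoundaryPair (-A₀).adjoint.domain.subtype (-A₀).adjoint.toFun Γm Γp :=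
    ⟨hq.1, hq.2.1, hq.2.2.1, hq.2.2.2⟩
  obtain ⟨_, _, hker⟩ := hmax.exists_isBoundaryPair_ker
  refine ⟨(exists_mDissipative_extension_iff hdense hskew).trans
    (hpair.exists_eq_boundaryAnnihilator_iff hmax), ?_⟩
  rw [← hpair.exists_eq_boundaryAnnihilator_iff hmax, hker.exists_eq_boundaryAnnihilator_iff hmax]
  exact ⟨fun ⟨U⟩ => ⟨U.symm⟩, fun ⟨U⟩ => ⟨U.symm⟩⟩
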